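/- Let f be an nc self-map of 𝔅_d with f₁(0) = 0, and let V₁ = {v ∈ 𝔅_d(1) : f₁(v) = v} be the fixed-point set of f at level 1. Then for every n ≥ 1, every X ∈ 𝔅_d(n) whose coordinates satisfy all homogeneous linear relations of V₁ — that is, such that Σ_{j=1}^d α_j X_j = 0 for every α ∈ ℂ^d with Σ_{j=1}^d α_j v_j = 0 for all v ∈ V₁ — is fixed by f_n: f_n(X) = X. -/

import Mathlib

open Matrix
open scoped ComplexOrder

attribute [local instance] Matrix.normedAddCommGroup Matrix.normedSpace

/-- The space of `d`-tuples of `n × n` complex matrices. -/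
abbrev MatTuple (d n : ℕ) := Fin d → Matrix (Fin n) (Fin n) ℂ

/-- The free matrix ball at level `n`: strict row contractions. -/
def freeBall (d n : ℕ) : Set (MatTuple d n) :=
  {X | (1 - ∑ j, X j * (X j)ᴴ).PosDef}

/-- The direct sum of two tuples of matrices. -/
def dSum {d n m : ℕ} (X : MatTuple d n) (Y : MatTuple d m) : MatTuple d (n + m) :=
  fun j => Matrix.reindex finSumFinEquiv finSumFinEquiv (Matrix.fromBlocks (X j) 0 0 (Y j))

/-- An nc self-map of the free ball `𝔅_d`. -/
structure NCSelfMap (d : ℕ) where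
  app : ∀ n, MatTuple d n → MatTuple d n
  mapsTo : ∀ n, Set.MapsTo (app n) (freeBall d n) (freeBall d n)
  map_dSum : ∀ {n m : ℕ} (X : MatTuple d n) (Y : MatTuple d m),
    X ∈ freeBall d n → Y ∈ freeBall d m →
    app (n + m) (dSum X Y) = dSum (app n X) (app m Y)
  map_sim : ∀ {n : ℕ} (X : MatTuple d n) (S : Matrix (Fin n) (Fin n) ℂ),
    X ∈ freeBall d n → IsUnit S →
    (fun j => S⁻¹ * X j * S) ∈ freeBall d n →
    app n (fun j => S⁻¹ * X j * S) = fun j => S⁻¹ * app n X j * S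
  holo : ∀ n, DifferentiableOn ℂ (app n) (freeBall d n)

/-- A tuple is generic if its coordinates generate the full matrix algebra. -/
def IsGeneric {d n : ℕ} (X : MatTuple d n) : Prop :=
  Algebra.adjoin ℂ (Set.range X) = ⊤

/-- The homogeneous degree-one linear relations satisfied by the coordinates of `X`. -/
def linRel {d n : ℕ} (X : MatTuple d n) : Set (Fin d → ℂ) :=
  {α | ∑ j, α j • X j = 0}

/-- The scalar point of level `n` associated to a vector in `ℂ^d`. -/
def scalarPt (d n : ℕ) (v : Fin d → ℂ) : MatTuple d n :=
  fun j => v j • (1 : Matrix (Fin n) (Fin n) ℂ)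

open Set Filter Topology Metric

/-- The `a`-th row of the block row matrix `[X₁ ⋯ X_d]`, as a vector of a Euclidean space. -/
noncomputable def rowVec {d n : ℕ} (a : Fin n) :
    MatTuple d n →L[ℂ] EuclideanSpace ℂ (Fin d × Fin n) :=
  LinearMap.toContinuousLinearMap
    { toFun := fun X => WithLp.toLp 2 fun p => X p.1 a p.2
      map_add' := fun X Y => by ext; simp
      map_smul' := fun c X => by ext; simp }

@[simp]
lemma rowVec_apply {d n : ℕ} (a : Fin n) (X : MatTuple d n) (p : Fin d × Fin n) :
    rowVec a X p = X p.1 a p.2 := rfl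

lemma norm_rowVec_sq {d n : ℕ} (a : Fin n) (X : MatTuple d n) :
    ((‖rowVec a X‖ ^ 2 : ℝ) : ℂ) = (∑ j, X j * (X j)ᴴ) a a := by
  rw [EuclideanSpace.norm_sq_eq, Fintype.sum_prod_type]
  simp [Matrix.sum_apply, Matrix.mul_apply, Complex.mul_conj, Complex.normSq_eq_norm_sq]

lemma norm_rowVec_lt_one {d n : ℕ} (a : Fin n) {X : MatTuple d n} (hX : X ∈ freeBall d n) :
    ‖rowVec a X‖ < 1 := by
  have h := Matrix.PosDef.diag_pos hX (i := a)
  rw [Matrix.sub_apply, Matrix.one_apply_eq, ← norm_rowVec_sq] at h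
  have h' : 0 < 1 - ‖rowVec a X‖ ^ 2 := by exact_mod_cast h
  nlinarith [norm_nonneg (rowVec a X)]

lemma norm_rowVec_eq_one {d n : ℕ} (a : Fin n) {U : MatTuple d n}
    (hU : ∑ j, U j * (U j)ᴴ = 1) : ‖rowVec a U‖ = 1 := by
  have h := norm_rowVec_sq a U
  rw [hU, Matrix.one_apply_eq] at h
  have h' : ‖rowVec a U‖ ^ 2 = 1 := by exact_mod_cast h
  nlinarith [norm_nonneg (rowVec a U)]

lemma rowVec_ext {d n : ℕ} {X Y : MatTuple d n} (h : ∀ a, rowVec a X = rowVec a Y) : X = Y := by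
  funext j
  ext a b
  simpa using congrArg (fun v => v (j, b)) (h a)

/-- The Schwarz lemma for the free ball: a holomorphic map of the disc into the ball whose
difference quotient at the origin attains a row coisometry is linear. -/
lemma eq_smul_of_dslope_eq_coisometry {d n : ℕ} {F : ℂ → MatTuple d n} {U : MatTuple d n} {z₀ : ℂ}
    (hF : DifferentiableOn ℂ F (ball 0 1)) (hmaps : MapsTo F (ball 0 1) (freeBall d n))
    (hF0 : F 0 = 0) (hU : ∑ j, U j * (U j)ᴴ = 1) (hz₀ : z₀ ∈ ball (0 : ℂ) 1)
    (hslope : dslope F 0 z₀ = U) {z : ℂ} (hz : z ∈ ball (0 : ℂ) 1) : F z = z • U := by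
  refine rowVec_ext fun a => ?_
  have hs : dslope (rowVec a ∘ F) 0 z₀ = rowVec a U := by
    refine ((rowVec a).dslope_comp F 0 z₀ fun _ => ?_).trans (congrArg (rowVec a) hslope)
    exact hF.differentiableAt (ball_mem_nhds _ one_pos)
  have key := Complex.affine_of_mapsTo_ball_of_norm_dslope_eq_div (f := rowVec a ∘ F) (c := 0)
    (R₁ := 1) (R₂ := 1) (z₀ := z₀) ((rowVec a).differentiable.comp_differentiableOn hF)
    (fun w hw => by simpa [hF0] using (norm_rowVec_lt_one a (hmaps hw)).le) hz₀
    (by rw [hs, norm_rowVec_eq_one a hU]; norm_num) hz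
  simpa [hF0, hs] using key

lemma smul_mem_freeBall_of_coisometry {d n : ℕ} {U : MatTuple d n}
    (hU : ∑ j, U j * (U j)ᴴ = 1) {z : ℂ} (hz : z ∈ ball (0 : ℂ) 1) : z • U ∈ freeBall d n := by
  have h : ∑ j, (z • U) j * ((z • U) j)ᴴ = Matrix.diagonal fun _ => ((‖z‖ ^ 2 : ℝ) : ℂ) := by
    simp only [Pi.smul_apply, conjTranspose_smul, smul_mul_smul_comm, ← Finset.smul_sum, hU]
    rw [smul_one_eq_diagonal]
    simp [Complex.mul_conj, Complex.normSq_eq_norm_sq]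
  rw [freeBall, mem_ofPred_eq, h, ← diagonal_one, diagonal_sub, posDef_diagonal_iff]
  intro _
  have : ‖z‖ < 1 := by simpa using hz
  have h2 : 0 < 1 - ‖z‖ ^ 2 := by nlinarith [norm_nonneg z]
  exact_mod_cast h2

lemma isOpen_freeBall (d n : ℕ) : IsOpen (freeBall d n) := by
  have hherm (X : MatTuple d n) : (1 - ∑ j, X j * (X j)ᴴ).IsHermitian :=
    isHermitian_one.sub (by simp [IsHermitian, conjTranspose_sum])
  have hcont : Continuous fun p : MatTuple d n × (Fin n → ℂ) =>
      (star p.2 ⬝ᵥ ((1 - ∑ j, p.1 j * (p.1 j)ᴴ) *ᵥ p.2)).re := by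
    fun_prop
  rw [isOpen_iff_mem_nhds]
  intro X hX
  have h := (isCompact_sphere (0 : Fin n → ℂ) 1).eventually_forall_of_forall_eventually
    (x₀ := X) (P := fun Y x => 0 < (star x ⬝ᵥ ((1 - ∑ j, Y j * (Y j)ᴴ) *ᵥ x)).re) (by
      intro x hx
      have hx0 : x ≠ 0 := by rintro rfl; simp at hx
      have := (Complex.lt_def.1 (hX.dotProduct_mulVec_pos hx0)).1
      exact hcont.continuousAt.eventually (lt_mem_nhds this))
  filter_upwards [h] with Y hY
  refine .of_dotProduct_mulVec_pos (hherm Y) fun x hx => ?_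
  have hx' : (‖x‖ : ℂ) ≠ 0 := by simpa using hx
  have h1 := hY ((‖x‖ : ℂ)⁻¹ • x) (by
    have := norm_ne_zero_iff.2 hx
    simp [norm_smul, this])
  have him : (star x ⬝ᵥ ((1 - ∑ j, Y j * (Y j)ᴴ) *ᵥ x)).im = 0 :=
    (hherm Y).im_star_dotProduct_mulVec_self x
  rw [Complex.lt_def]
  refine ⟨?_, by simp [him]⟩
  rw [mulVec_smul, star_smul, smul_dotProduct, dotProduct_smul] at h1
  simp only [RCLike.star_def, Complex.conj_ofReal, smul_eq_mul, ← mul_assoc,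
    ← Complex.ofReal_inv, ← Complex.ofReal_mul, Complex.re_ofReal_mul] at h1
  exact (pos_iff_pos_of_mul_pos h1).1 (mul_self_pos.2 (by simpa using hx))

lemma zero_mem_freeBall (d n : ℕ) : (0 : MatTuple d n) ∈ freeBall d n := by
  simpa [freeBall] using PosDef.one

lemma diagonal_mem_freeBall {d n : ℕ} {v : MatTuple d 1} (hv : v ∈ freeBall d 1) {c : Fin n → ℂ}
    (hc : ∀ i, ‖c i‖ ≤ 1) : (fun j => Matrix.diagonal fun i => c i * v j 0 0) ∈ freeBall d n := by
  have hv' : ∑ j, ‖v j 0 0‖ ^ 2 < 1 := by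
    have h := norm_rowVec_lt_one 0 hv
    have h2 : ‖rowVec 0 v‖ ^ 2 < 1 := by nlinarith [norm_nonneg (rowVec 0 v)]
    simpa [EuclideanSpace.norm_sq_eq, Fintype.sum_prod_type] using h2
  have h : ∑ j, (Matrix.diagonal fun i => c i * v j 0 0) *
      (Matrix.diagonal fun i => c i * v j 0 0)ᴴ =
      Matrix.diagonal fun i => ((‖c i‖ ^ 2 * ∑ j, ‖v j 0 0‖ ^ 2 : ℝ) : ℂ) := by
    simp_rw [diagonal_conjTranspose, diagonal_mul_diagonal]
    ext a b
    rw [Matrix.sum_apply]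
    by_cases hab : a = b
    · subst hab
      simp only [Finset.mul_sum, Matrix.diagonal_apply_eq, Complex.ofReal_sum]
      refine Finset.sum_congr rfl fun j _ => ?_
      simp only [Pi.star_apply, star_mul', RCLike.star_def]
      rw [mul_mul_mul_comm, Complex.mul_conj', Complex.mul_conj']
      push_cast
      rfl
    · simp [hab]
  rw [freeBall, mem_ofPred_eq, h, ← diagonal_one, diagonal_sub, posDef_diagonal_iff]
  intro i
  have h1 : ‖c i‖ ^ 2 ≤ 1 := by nlinarith [hc i, norm_nonneg (c i)]
  have h2 : 0 < 1 - ‖c i‖ ^ 2 * ∑ j, ‖v j 0 0‖ ^ 2 := by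
    have : 0 ≤ ∑ j, ‖v j 0 0‖ ^ 2 := by positivity
    nlinarith
  exact_mod_cast h2

lemma hasDerivAt_smul_tuple {d n : ℕ} (X : MatTuple d n) :
    HasDerivAt (fun t : ℂ => t • X) X 0 := by
  have h := (hasDerivAt_id (0 : ℂ)).smul_const X
  rwa [one_smul] at h

/-- A positive definite strict contraction is unitarily diagonalizable with eigenvalues that are
squares of numbers in `(0, 1)`. -/
lemma exists_diagonalization {n : ℕ} {G : Matrix (Fin n) (Fin n) ℂ} (hG : G.PosDef)
    (hG1 : (1 - G).PosDef) :
    ∃ (V : Matrix (Fin n) (Fin n) ℂ) (s : Fin n → ℝ), Vᴴ * V = 1 ∧ V * Vᴴ = 1 ∧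
      (∀ i, 0 < s i) ∧ (∀ i, s i < 1) ∧
      G = V * Matrix.diagonal (fun i => (s i : ℂ) ^ 2) * Vᴴ := by
  set V : Matrix (Fin n) (Fin n) ℂ := ↑hG.isHermitian.eigenvectorUnitary
  set l := hG.isHermitian.eigenvalues
  have hVV : Vᴴ * V = 1 := Unitary.coe_star_mul_self _
  have hVV' : V * Vᴴ = 1 := Unitary.coe_mul_star_self _
  have hspec : G = V * Matrix.diagonal (fun i => (l i : ℂ)) * Vᴴ := by
    conv_lhs => rw [hG.isHermitian.spectral_theorem, Unitary.conjStarAlgAut_apply]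
    rfl
  have hl0 : ∀ i, 0 < l i := hG.eigenvalues_pos
  have hl1 : ∀ i, l i < 1 := by
    have h : (1 - G) = V * Matrix.diagonal (fun i => ((1 - l i : ℝ) : ℂ)) * Vᴴ := by
      have : Matrix.diagonal (fun i => ((1 - l i : ℝ) : ℂ)) =
          1 - Matrix.diagonal fun i => (l i : ℂ) := by
        rw [← diagonal_one, diagonal_sub]; simp
      rw [this, mul_sub, sub_mul, mul_one, hVV', ← hspec]
    rw [h] at hG1
    have h2 := ((IsUnit.of_mul_eq_one Vᴴ hVV').posDef_star_right_conjugate_iff).1 hG1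
    intro i
    have h3 := posDef_diagonal_iff.1 h2 i
    have h4 : 0 < 1 - l i := by exact_mod_cast h3
    linarith
  refine ⟨V, fun i => √(l i), hVV, hVV', fun i => Real.sqrt_pos.2 (hl0 i),
    fun i => (Real.sqrt_lt' one_pos).2 (by simpa using hl1 i), ?_⟩
  simpa only [← Complex.ofReal_pow, Real.sq_sqrt (hl0 _).le] using hspec

section Mobius

variable {r s : ℝ} {z : ℂ}

lemma mobius_denom_ne_zero (hs : 0 < s) (hsr : s < r) (hz : ‖z‖ ≤ 1) : (r : ℂ) + z * s ≠ 0 := by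
  intro h
  have h1 : ‖(r : ℂ)‖ = ‖z * s‖ := by rw [eq_neg_of_add_eq_zero_left h, norm_neg]
  rw [norm_mul, Complex.norm_real, Complex.norm_real, Real.norm_of_nonneg (hs.trans hsr).le,
    Real.norm_of_nonneg hs.le] at h1
  nlinarith

lemma mobius_norm_sq_sub (r s : ℝ) (z : ℂ) :
    ‖(r : ℂ) + z * s‖ ^ 2 - ‖(s : ℂ) + r * z‖ ^ 2 = (r ^ 2 - s ^ 2) * (1 - ‖z‖ ^ 2) := by
  simp only [← Complex.normSq_eq_norm_sq, Complex.normSq_apply]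
  simp
  ring

lemma norm_mobius_le (hs : 0 < s) (hsr : s < r) (hz : ‖z‖ ≤ 1) :
    ‖((s : ℂ) + r * z) / (r + z * s)‖ ≤ 1 := by
  rw [norm_div]
  refine div_le_one_of_le₀ ?_ (norm_nonneg _)
  have h := mobius_norm_sq_sub r s z
  have h1 : 0 ≤ r ^ 2 - s ^ 2 := by nlinarith
  have h2 : 0 ≤ 1 - ‖z‖ ^ 2 := by nlinarith [norm_nonneg z]
  exact (pow_le_pow_iff_left₀ (norm_nonneg _) (norm_nonneg _) two_ne_zero).1
    (by linarith [mul_nonneg h1 h2])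

lemma norm_mobius_eq (hs : 0 < s) (hsr : s < r) (hz : ‖z‖ = 1) :
    ‖((s : ℂ) + r * z) / (r + z * s)‖ = 1 := by
  have h := mobius_norm_sq_sub r s z
  rw [hz, one_pow, sub_self, mul_zero, sub_eq_zero] at h
  rw [norm_div, div_eq_one_iff_eq (norm_ne_zero_iff.2 (mobius_denom_ne_zero hs hsr hz.le))]
  exact ((pow_left_inj₀ (norm_nonneg _) (norm_nonneg _) two_ne_zero).1 h).symm

end Mobius

/-- Left multiplication of the coordinates of `U` by `V diag(c) V*`, as a function of `c`. -/
noncomputable def diagConjMul {d n : ℕ} (V : Matrix (Fin n) (Fin n) ℂ) (U : MatTuple d n) :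
    (Fin n → ℂ) →L[ℂ] MatTuple d n :=
  LinearMap.toContinuousLinearMap
    { toFun := fun c j => V * Matrix.diagonal c * Vᴴ * U j
      map_add' := fun c c' => by
        funext j
        have h : Matrix.diagonal (c + c') = Matrix.diagonal c + Matrix.diagonal c' :=
          (Matrix.diagonal_add c c').symm
        simp only [Pi.add_apply, h, mul_add, add_mul]
      map_smul' := fun t c => by funext j; simp }

lemma diagConjMul_apply {d n : ℕ} (V : Matrix (Fin n) (Fin n) ℂ) (U : MatTuple d n)
    (c : Fin n → ℂ) : diagConjMul V U c = fun j => V * Matrix.diagonal c * Vᴴ * U j := rfl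

lemma gram_diagConjMul {d n : ℕ} {V : Matrix (Fin n) (Fin n) ℂ} (hV : Vᴴ * V = 1)
    {U : MatTuple d n} {g : Fin n → ℂ}
    (hU : ∑ j, U j * (U j)ᴴ = V * Matrix.diagonal g * Vᴴ) (c : Fin n → ℂ) :
    ∑ j, diagConjMul V U c j * (diagConjMul V U c j)ᴴ =
      V * Matrix.diagonal (fun i => c i * g i * star (c i)) * Vᴴ := by
  have h : ∀ j, diagConjMul V U c j * (diagConjMul V U c j)ᴴ =
      V * Matrix.diagonal c * Vᴴ * (U j * (U j)ᴴ) * (V * Matrix.diagonal c * Vᴴ)ᴴ := fun j => by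
    rw [diagConjMul_apply, conjTranspose_mul _ (U j)]
    simp only [mul_assoc]
  simp_rw [h]
  rw [← Matrix.sum_mul, ← Matrix.mul_sum, hU]
  have h2 : V * Matrix.diagonal c * Vᴴ * (V * Matrix.diagonal g * Vᴴ) *
      (V * Matrix.diagonal c * Vᴴ)ᴴ =
      V * (Matrix.diagonal c * (Vᴴ * V) * Matrix.diagonal g * (Vᴴ * V) * (Matrix.diagonal c)ᴴ) *
        Vᴴ := by
    simp only [conjTranspose_mul, conjTranspose_conjTranspose, mul_assoc]
  rw [h2, hV, mul_one, mul_one, diagonal_conjTranspose, diagonal_mul_diagonal,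
    diagonal_mul_diagonal]
  rfl

lemma diagConjMul_mem_freeBall {d n : ℕ} {V : Matrix (Fin n) (Fin n) ℂ} (hV : Vᴴ * V = 1)
    (hV' : V * Vᴴ = 1) {U : MatTuple d n} (hU : ∑ j, U j * (U j)ᴴ = 1) {c : Fin n → ℂ}
    (hc : ∀ i, ‖c i‖ < 1) : diagConjMul V U c ∈ freeBall d n := by
  have h := gram_diagConjMul hV (U := U) (g := 1) (by rw [hU, Pi.one_def, diagonal_one, mul_one, hV'])
    c
  have h1 : 1 - ∑ j, diagConjMul V U c j * (diagConjMul V U c j)ᴴ =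
      V * Matrix.diagonal (fun i => ((1 - ‖c i‖ ^ 2 : ℝ) : ℂ)) * Vᴴ := by
    have : Matrix.diagonal (fun i => ((1 - ‖c i‖ ^ 2 : ℝ) : ℂ)) =
        1 - Matrix.diagonal fun i => c i * (1 : Fin n → ℂ) i * star (c i) := by
      rw [← diagonal_one, diagonal_sub]; simp [Complex.mul_conj']
    rw [h, this, mul_sub, sub_mul, mul_one, hV']
  rw [freeBall, mem_ofPred_eq, h1]
  refine ((IsUnit.of_mul_eq_one Vᴴ hV').posDef_star_right_conjugate_iff).2
    (posDef_diagonal_iff.2 fun i => ?_)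
  have h2 : 0 < 1 - ‖c i‖ ^ 2 := by nlinarith [hc i, norm_nonneg (c i)]
  exact_mod_cast h2

lemma posDef_gram_of_isUnit_sum {d n : ℕ} {Y : MatTuple d n} (β : Fin d → ℂ)
    (h : IsUnit (∑ j, β j • Y j)) : (∑ j, Y j * (Y j)ᴴ).PosDef := by
  refine .of_dotProduct_mulVec_pos (by simp [IsHermitian, conjTranspose_sum]) fun x hx => ?_
  have hsum : star x ⬝ᵥ ((∑ j, Y j * (Y j)ᴴ) *ᵥ x) = ∑ j, star ((Y j)ᴴ *ᵥ x) ⬝ᵥ ((Y j)ᴴ *ᵥ x) := by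
    simp only [Matrix.sum_mulVec, dotProduct_sum]
    refine Finset.sum_congr rfl fun j _ => ?_
    rw [star_mulVec, conjTranspose_conjTranspose, ← dotProduct_mulVec, mulVec_mulVec]
  rw [hsum]
  refine Finset.sum_pos' (fun j _ => dotProduct_star_self_nonneg _) ?_
  by_contra! hcon
  have hzero (j : Fin d) : (Y j)ᴴ *ᵥ x = 0 := by
    by_contra hne
    exact hcon j (Finset.mem_univ j) (dotProduct_star_self_pos_iff.2 hne)
  refine hx (mulVec_injective_of_isUnit h.star ?_)
  rw [star_eq_conjTranspose, conjTranspose_sum, mulVec_zero, Matrix.sum_mulVec]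
  simp [smul_mulVec, hzero]

namespace NCSelfMap

variable {d : ℕ} (f : NCSelfMap d)

lemma app_one_smul (hf0 : f.app 1 0 = 0) {v : MatTuple d 1} (hv : v ∈ freeBall d 1)
    (hfix : f.app 1 v = v) {z : ℂ} (hz : ‖z‖ ≤ 1) : f.app 1 (z • v) = z • v := by
  rcases eq_or_ne v 0 with rfl | hv0
  · simpa using hf0
  set c : ℝ := ‖rowVec 0 v‖ with hc
  have hc1 : c < 1 := norm_rowVec_lt_one 0 hv
  have hc0 : 0 < c := by
    refine norm_pos_iff.2 fun h => hv0 (rowVec_ext fun a => ?_)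
    rw [Subsingleton.elim a 0, h, map_zero]
  have hcC : (c : ℂ) ≠ 0 := by exact_mod_cast hc0.ne'
  set u : MatTuple d 1 := (c : ℂ)⁻¹ • v with hu
  have hcu : (c : ℂ) • u = v := by rw [hu, smul_inv_smul₀ hcC]
  have hcoiso : ∑ j, u j * (u j)ᴴ = 1 := by
    ext a b
    rw [Subsingleton.elim b a, Subsingleton.elim a 0, ← norm_rowVec_sq, hu, map_smul, norm_smul,
      ← hc]
    simp [abs_of_pos hc0, hc0.ne']
  have hmaps : MapsTo (fun w : ℂ => w • u) (ball 0 1) (freeBall d 1) := fun w hw =>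
    smul_mem_freeBall_of_coisometry hcoiso hw
  have hcmem : (c : ℂ) ∈ ball (0 : ℂ) 1 := by simpa [abs_of_pos hc0] using hc1
  have hslope : dslope (fun w : ℂ => f.app 1 (w • u)) 0 c = u := by
    rw [dslope_of_ne _ hcC, slope_def_module, zero_smul, hf0, hcu, hfix, sub_zero, sub_zero]
  have hzc : z * c ∈ ball (0 : ℂ) 1 := by
    simp only [mem_ball_zero_iff, norm_mul, Complex.norm_real, Real.norm_eq_abs, abs_of_pos hc0]
    nlinarith
  have key := eq_smul_of_dslope_eq_coisometry (F := fun w : ℂ => f.app 1 (w • u))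
    ((f.holo 1).comp (by fun_prop) hmaps) ((f.mapsTo 1).comp hmaps)
    (by simpa using hf0) hcoiso hcmem hslope hzc
  simpa only [mul_smul, hcu] using key

lemma app_diagonal (hf0 : f.app 1 0 = 0) {v : MatTuple d 1} (hv : v ∈ freeBall d 1)
    (hfix : f.app 1 v = v) {n : ℕ} (c : Fin n → ℂ) (hc : ∀ i, ‖c i‖ ≤ 1) :
    f.app n (fun j => Matrix.diagonal fun i => c i * v j 0 0) =
      fun j => Matrix.diagonal fun i => c i * v j 0 0 := by
  induction n with
  | zero => funext j; ext a; exact a.elim0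
  | succ n ih =>
    have hsplit : (fun j => Matrix.diagonal fun i => c i * v j 0 0) =
        dSum (fun j => Matrix.diagonal fun i : Fin n => c i.castSucc * v j 0 0)
          (c (Fin.last n) • v) := by
      funext j
      ext a b
      have hlast : Fin.last n = Fin.natAdd n (0 : Fin 1) := rfl
      have hcast (i : Fin n) : i.castSucc = Fin.castAdd 1 i := rfl
      induction a using Fin.lastCases <;> induction b using Fin.lastCases <;>
        simp only [hlast, hcast, dSum, reindex_apply, submatrix_apply,
          finSumFinEquiv_symm_apply_natAdd, finSumFinEquiv_symm_apply_castAdd] <;>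
        simp [Matrix.diagonal_apply, Fin.ext_iff]
      all_goals omega
    have hlast : (c (Fin.last n) • v) ∈ freeBall d 1 := by
      convert diagonal_mem_freeBall hv (c := fun _ : Fin 1 => c (Fin.last n)) fun _ => hc _ using 1
      funext j
      ext a b
      simp [Subsingleton.elim a 0, Subsingleton.elim b 0]
    rw [hsplit, f.map_dSum _ _ (diagonal_mem_freeBall hv fun i => hc _) hlast,
      ih _ fun i => hc _, f.app_one_smul hf0 hv hfix (hc _)]

lemma app_zero (hf0 : f.app 1 0 = 0) (n : ℕ) : f.app n 0 = 0 := by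
  simpa [← Pi.zero_def] using
    f.app_diagonal hf0 (zero_mem_freeBall d 1) hf0 (n := n) 0 (by simp)

lemma differentiableAt {n : ℕ} {X : MatTuple d n} (hX : X ∈ freeBall d n) :
    DifferentiableAt ℂ (f.app n) X :=
  (f.holo n).differentiableAt ((isOpen_freeBall d n).mem_nhds hX)

lemma hasDerivAt_app_smul {n : ℕ} (X : MatTuple d n) :
    HasDerivAt (fun t : ℂ => f.app n (t • X)) (fderiv ℂ (f.app n) 0 X) 0 := by
  refine HasFDerivAt.comp_hasDerivAt (0 : ℂ) ?_ (hasDerivAt_smul_tuple X)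
  rw [zero_smul]
  exact (f.differentiableAt (zero_mem_freeBall d n)).hasFDerivAt

lemma fderiv_zero_eq_of_eventually {n : ℕ} {X : MatTuple d n}
    (h : ∀ᶠ t : ℂ in 𝓝 0, f.app n (t • X) = t • X) : fderiv ℂ (f.app n) 0 X = X :=
  (f.hasDerivAt_app_smul X).unique ((hasDerivAt_smul_tuple X).congr_of_eventuallyEq h)

lemma eventually_smul_mem {n : ℕ} (X : MatTuple d n) : ∀ᶠ t : ℂ in 𝓝 0, t • X ∈ freeBall d n := by
  have : Tendsto (fun t : ℂ => t • X) (𝓝 0) (𝓝 0) := by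
    have h : Continuous fun t : ℂ => t • X := by fun_prop
    simpa using h.tendsto 0
  exact this.eventually ((isOpen_freeBall d n).mem_nhds (zero_mem_freeBall d n))

lemma eventually_app_smul_conj {n : ℕ} {X : MatTuple d n} {S : Matrix (Fin n) (Fin n) ℂ}
    (hS : IsUnit S) (h : ∀ᶠ t : ℂ in 𝓝 0, f.app n (t • X) = t • X) :
    ∀ᶠ t : ℂ in 𝓝 0, f.app n (t • fun j => S⁻¹ * X j * S) = t • fun j => S⁻¹ * X j * S := by
  filter_upwards [h, eventually_smul_mem X, eventually_smul_mem fun j => S⁻¹ * X j * S]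
    with t ht hX hSX
  have heq : (t • fun j => S⁻¹ * X j * S) = fun j => S⁻¹ * (t • X) j * S := by
    funext j
    simp
  rw [heq] at hSX ⊢
  rw [f.map_sim _ S hX hS hSX, ht]

/-- The derivative at the origin fixes `v ⊗ E` for every level-one fixed point `v` and every
matrix unit `E`. -/
lemma fderiv_zero_single (hf0 : f.app 1 0 = 0) {v : MatTuple d 1} (hv : v ∈ freeBall d 1)
    (hfix : f.app 1 v = v) {n : ℕ} (a b : Fin n) :
    fderiv ℂ (f.app n) 0 (fun j => Matrix.single a b (v j 0 0)) =
      fun j => Matrix.single a b (v j 0 0) := by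
  have hdiag : ∀ᶠ t : ℂ in 𝓝 0, f.app n (t • fun j => Matrix.single a a (v j 0 0)) =
      t • fun j => Matrix.single a a (v j 0 0) := by
    filter_upwards [closedBall_mem_nhds (0 : ℂ) one_pos] with t ht
    have heq : (t • fun j => Matrix.single a a (v j 0 0)) =
        fun j => Matrix.diagonal fun i => (Pi.single a t : Fin n → ℂ) i * v j 0 0 := by
      funext j
      rw [Pi.smul_apply, ← Matrix.diagonal_single, ← Matrix.diagonal_smul]
      congr 1
      funext i
      by_cases hi : i = a <;> simp [hi]
    rw [heq]
    refine f.app_diagonal hf0 hv hfix _ fun i => ?_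
    by_cases hi : i = a
    · subst hi; simpa using ht
    · simp [hi]
  rcases eq_or_ne a b with rfl | hab
  · exact f.fderiv_zero_eq_of_eventually hdiag
  have hmul : transvection a b (-1 : ℂ) * transvection a b 1 = 1 := by
    rw [transvection_mul_transvection_same a b hab]; simp
  have hinv : (transvection a b (1 : ℂ))⁻¹ = transvection a b (-1) := inv_eq_left_inv hmul
  have hconj : (fun j => (transvection a b (1 : ℂ))⁻¹ * Matrix.single a a (v j 0 0) *
      transvection a b 1) =
      (fun j => Matrix.single a a (v j 0 0)) + fun j => Matrix.single a b (v j 0 0) := by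
    funext j
    rw [hinv]
    simp [transvection, add_mul, mul_add, hab.symm]
  have h := f.fderiv_zero_eq_of_eventually
    (f.eventually_app_smul_conj (IsUnit.of_mul_eq_one_right _ hmul) hdiag)
  rw [hconj, map_add, f.fderiv_zero_eq_of_eventually hdiag] at h
  exact add_left_cancel h

/-- The coordinates of `X` satisfy all homogeneous linear relations of the level-one fixed
points of `f`. -/
def SatisfiesFixedRelations {n : ℕ} (X : MatTuple d n) : Prop :=
  ∀ α : Fin d → ℂ, (∀ v ∈ freeBall d 1, f.app 1 v = v → ∑ j, α j • v j = 0) →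
    ∑ j, α j • X j = 0

variable {f}

lemma SatisfiesFixedRelations.left_mul {n : ℕ} {X : MatTuple d n}
    (hX : f.SatisfiesFixedRelations X) (M : Matrix (Fin n) (Fin n) ℂ) :
    f.SatisfiesFixedRelations fun j => M * X j := by
  intro α hα
  simp_rw [← Matrix.mul_smul]
  rw [← Matrix.mul_sum, hX α hα, Matrix.mul_zero]

lemma SatisfiesFixedRelations.fderiv_zero (hf0 : f.app 1 0 = 0) {n : ℕ} {X : MatTuple d n}
    (hX : f.SatisfiesFixedRelations X) : fderiv ℂ (f.app n) 0 X = X := by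
  set K : Submodule ℂ (MatTuple d n) :=
    LinearMap.eqLocus (fderiv ℂ (f.app n) 0).toLinearMap LinearMap.id with hK
  suffices X ∈ K from this
  have hsum : X = ∑ a, ∑ b, fun j => Matrix.single a b (X j a b) := by
    funext j
    simp only [Finset.sum_apply]
    exact matrix_eq_sum_single (X j)
  rw [hsum]
  refine K.sum_mem fun a _ => K.sum_mem fun b _ => ?_
  let L : (Fin d → ℂ) →ₗ[ℂ] MatTuple d n :=
    LinearMap.pi fun j => (Matrix.singleLinearMap ℂ a b).comp (LinearMap.proj j)
  let V : Set (Fin d → ℂ) := {w | ∃ v ∈ freeBall d 1, f.app 1 v = v ∧ w = fun j => v j 0 0}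
  have hspan : Submodule.span ℂ V ≤ K.comap L := by
    rw [Submodule.span_le]
    rintro _ ⟨v, hv, hfix, rfl⟩
    exact f.fderiv_zero_single hf0 hv hfix a b
  refine hspan (x := fun j => X j a b) ?_
  by_contra hnot
  obtain ⟨φ, hφ, hker⟩ := Submodule.exists_le_ker_of_notMem hnot
  have hφ_apply (w : Fin d → ℂ) : φ w = ∑ j, φ (Pi.single j 1) * w j := by
    conv_lhs => rw [pi_eq_sum_univ' w, map_sum]
    simp [mul_comm]
  refine hφ ?_
  have h := hX (fun j => φ (Pi.single j 1)) fun v hv hfix => by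
    have h := hker (Submodule.subset_span ⟨v, hv, hfix, rfl⟩)
    rw [LinearMap.mem_ker, hφ_apply] at h
    ext i k
    simpa [Matrix.sum_apply, Subsingleton.elim i 0, Subsingleton.elim k 0] using h
  rw [hφ_apply]
  simpa [Matrix.sum_apply] using congrFun₂ h a b

lemma SatisfiesFixedRelations.app_smul_of_coisometry (hf0 : f.app 1 0 = 0) {n : ℕ}
    {U : MatTuple d n} (hrel : f.SatisfiesFixedRelations U) (hU : ∑ j, U j * (U j)ᴴ = 1) {z : ℂ}
    (hz : z ∈ ball (0 : ℂ) 1) : f.app n (z • U) = z • U := by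
  have hmaps : MapsTo (fun w : ℂ => w • U) (ball 0 1) (freeBall d n) := fun w hw =>
    smul_mem_freeBall_of_coisometry hU hw
  refine eq_smul_of_dslope_eq_coisometry (F := fun w : ℂ => f.app n (w • U))
    ((f.holo n).comp (by fun_prop) hmaps) ((f.mapsTo n).comp hmaps)
    (by simpa using f.app_zero hf0 n) hU (mem_ball_self one_pos) ?_ hz
  rw [dslope_same, (f.hasDerivAt_app_smul U).deriv, hrel.fderiv_zero hf0]

lemma SatisfiesFixedRelations.app_eq_of_posDef (hf0 : f.app 1 0 = 0) {n : ℕ}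
    {X : MatTuple d n} (hrel : f.SatisfiesFixedRelations X) (hX : X ∈ freeBall d n)
    (hpos : (∑ j, X j * (X j)ᴴ).PosDef) : f.app n X = X := by
  obtain ⟨V, s, hV, hV', hs0, hs1, hG⟩ := exists_diagonalization hpos hX
  have hsC (i : Fin n) : (s i : ℂ) ≠ 0 := by exact_mod_cast (hs0 i).ne'
  obtain ⟨r, hr1, hr0, hsr⟩ : ∃ r : ℝ, r < 1 ∧ 0 < r ∧ ∀ i, s i < r := by
    have h : ∀ᶠ r : ℝ in 𝓝[<] 1, 0 < r ∧ ∀ i, s i < r := nhdsWithin_le_nhds <|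
      (lt_mem_nhds one_pos).and <| eventually_all.2 fun i => lt_mem_nhds (hs1 i)
    exact (eventually_mem_nhdsWithin.and h).exists
  have hrC : (r : ℂ) ≠ 0 := by exact_mod_cast hr0.ne'
  set U : MatTuple d n := diagConjMul V X fun i => (s i : ℂ)⁻¹ with hUdef
  have hU : ∑ j, U j * (U j)ᴴ = 1 := by
    have h1 : (fun i => (s i : ℂ)⁻¹ * (s i : ℂ) ^ 2 * star (s i : ℂ)⁻¹) = fun _ => 1 := by
      funext i
      have := hsC i
      simp only [RCLike.star_def, map_inv₀, Complex.conj_ofReal]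
      field_simp
    rw [hUdef, gram_diagConjMul hV hG, h1, diagonal_one, mul_one, hV']
  have hUrel (c : Fin n → ℂ) : f.SatisfiesFixedRelations (diagConjMul V U c) :=
    (hrel.left_mul _).left_mul _
  set m : ℂ → Fin n → ℂ := fun z i => r * (((s i : ℂ) + r * z) / (r + z * s i)) with hm
  have hmem : MapsTo (fun z => diagConjMul V U (m z)) (closedBall 0 1) (freeBall d n) := by
    intro z hz
    refine diagConjMul_mem_freeBall hV hV' hU fun i => ?_
    have := norm_mobius_le (hs0 i) (hsr i) (mem_closedBall_zero_iff.1 hz)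
    rw [hm, norm_mul, Complex.norm_real, Real.norm_of_nonneg hr0.le]
    nlinarith
  have hdiff : DifferentiableOn ℂ (fun z => diagConjMul V U (m z)) (closedBall 0 1) := by
    refine (diagConjMul V U).differentiable.comp_differentiableOn (differentiableOn_pi.2 fun i => ?_)
    refine (DifferentiableOn.div (by fun_prop) (by fun_prop) fun z hz => ?_).const_mul _
    exact mobius_denom_ne_zero (hs0 i) (hsr i) (mem_closedBall_zero_iff.1 hz)
  have hclosure : closure (ball (0 : ℂ) 1) = closedBall 0 1 := closure_ball _ one_ne_zero
  have hbdry : EqOn (fun z => f.app n (diagConjMul V U (m z))) (fun z => diagConjMul V U (m z))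
      (frontier (ball 0 1)) := by
    rw [frontier_ball _ one_ne_zero]
    intro z hz
    have hsplit : m z = (r : ℂ) • fun i => ((s i : ℂ) + r * z) / (r + z * s i) := rfl
    simp only [hsplit, map_smul]
    refine (hUrel _).app_smul_of_coisometry hf0 ?_ (by simpa [abs_of_pos hr0] using hr1)
    rw [gram_diagConjMul hV (g := 1) (by rw [hU, Pi.one_def, diagonal_one, mul_one, hV'])]
    have h1 : (fun i => ((s i : ℂ) + r * z) / (r + z * s i) * (1 : Fin n → ℂ) i *
        star (((s i : ℂ) + r * z) / (r + z * s i))) = fun _ => 1 := by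
      funext i
      rw [Pi.one_apply, mul_one, RCLike.star_def, Complex.mul_conj',
        norm_mobius_eq (hs0 i) (hsr i) (mem_sphere_zero_iff_norm.1 hz)]
      simp
    rw [h1, diagonal_one, mul_one, hV']
  have key := Complex.eqOn_of_eqOn_frontier isBounded_ball
    (DifferentiableOn.diffContOnCl (by rw [hclosure]; exact (f.holo n).comp hdiff hmem))
    (hdiff.diffContOnCl_ball (subset_refl _)) hbdry (mem_ball_self one_pos)
  have hcenter : diagConjMul V U (m 0) = X := by
    have h0 : m 0 = fun i => (s i : ℂ) := by
      funext i
      simp [hm, mul_div_cancel₀, hrC]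
    funext j
    have h2 : V * Matrix.diagonal (fun i => (s i : ℂ)) * Vᴴ *
        (V * Matrix.diagonal (fun i => (s i : ℂ)⁻¹) * Vᴴ * X j) =
        V * (Matrix.diagonal (fun i => (s i : ℂ)) * (Vᴴ * V) *
          Matrix.diagonal (fun i => (s i : ℂ)⁻¹)) * Vᴴ * X j := by
      simp only [mul_assoc]
    rw [h0, hUdef, diagConjMul_apply, diagConjMul_apply]
    refine h2.trans ?_
    rw [hV, mul_one, diagonal_mul_diagonal]
    simp [hsC, hV']
  simpa only [hcenter] using key

lemma SatisfiesFixedRelations.app_eq (hf0 : f.app 1 0 = 0) {n : ℕ} {X : MatTuple d n}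
    (hrel : f.SatisfiesFixedRelations X) (hX : X ∈ freeBall d n) : f.app n X = X := by
  by_cases htriv : ∀ v ∈ freeBall d 1, f.app 1 v = v → v = 0
  · have hX0 : X = 0 := by
      funext j
      simpa [Pi.single_apply] using hrel (Pi.single j 1) fun v hv hfix => by
        simp [htriv v hv hfix]
    rw [hX0, f.app_zero hf0]
  push Not at htriv
  obtain ⟨w, hw, hwfix, hw0⟩ := htriv
  set W : MatTuple d n := scalarPt d n fun j => w j 0 0 with hW
  have hWrel : f.SatisfiesFixedRelations W := by
    intro α hα
    have h := congrFun₂ (hα w hw hwfix) 0 0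
    simp only [hW, scalarPt, smul_smul, ← Finset.sum_smul]
    have h' : ∑ j, α j * w j 0 0 = 0 := by simpa [Matrix.sum_apply] using h
    rw [h', zero_smul]
  have hcont : Continuous fun t : ℂ => X + t • W := by fun_prop
  have htend : Tendsto (fun t : ℂ => X + t • W) (𝓝[≠] 0) (𝓝 X) := by
    have h := hcont.tendsto 0
    rw [zero_smul, add_zero] at h
    exact h.mono_left nhdsWithin_le_nhds
  set N : Matrix (Fin n) (Fin n) ℂ := ∑ j, star (w j 0 0) • X j with hN
  set ω : ℂ := ∑ j, star (w j 0 0) * w j 0 0 with hω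
  have hω0 : ω ≠ 0 := by
    have h : ω = ((‖rowVec 0 w‖ ^ 2 : ℝ) : ℂ) := by
      rw [norm_rowVec_sq]
      simp [hω, Matrix.sum_apply, Matrix.mul_apply, mul_comm]
    rw [h]
    have hne : rowVec 0 w ≠ 0 := fun h => hw0 <| rowVec_ext fun a => by
      rw [Subsingleton.elim a 0, h, map_zero]
    exact_mod_cast pow_ne_zero 2 (norm_ne_zero_iff.2 hne)
  have hunit : ∀ᶠ t : ℂ in 𝓝[≠] 0, IsUnit (N + (t * ω) • (1 : Matrix (Fin n) (Fin n) ℂ)) := by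
    have hfin : {t : ℂ | ¬ IsUnit (N + (t * ω) • (1 : Matrix (Fin n) (Fin n) ℂ))}.Finite := by
      refine ((Matrix.finite_spectrum (-N)).preimage
        (mul_left_injective₀ hω0).injOn).subset fun t ht => ?_
      rw [mem_preimage, spectrum.mem_iff, Algebra.algebraMap_eq_smul_one, sub_neg_eq_add, add_comm]
      exact ht
    have := (hfin.subset (sdiff_subset (t := {0}))).isClosed.isOpen_compl.mem_nhds
      (x := (0 : ℂ)) (by simp)
    rw [eventually_nhdsWithin_iff]
    filter_upwards [this] with t ht ht0
    by_contra hcon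
    exact ht ⟨hcon, ht0⟩
  have hfixed : ∀ᶠ t : ℂ in 𝓝[≠] 0, f.app n (X + t • W) = X + t • W := by
    filter_upwards [hunit, htend.eventually ((isOpen_freeBall d n).mem_nhds hX)] with t ht hmem
    refine SatisfiesFixedRelations.app_eq_of_posDef hf0 ?_ hmem ?_
    · intro α hα
      have h2 : ∑ j, α j • (t • W) j = t • ∑ j, α j • W j := by
        simp [Finset.smul_sum, smul_comm t]
      simp only [Pi.add_apply, smul_add, Finset.sum_add_distrib, h2, hrel α hα, hWrel α hα,
        smul_zero, add_zero]
    · set Y := X + t • W with hY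
      have hNY : N + (t * ω) • (1 : Matrix (Fin n) (Fin n) ℂ) = ∑ j, star (w j 0 0) • Y j := by
        simp [hY, hN, hω, hW, scalarPt, Finset.sum_add_distrib, smul_smul, Finset.mul_sum,
          Finset.sum_smul, mul_left_comm]
      exact posDef_gram_of_isUnit_sum _ (hNY ▸ ht)
  exact tendsto_nhds_unique
    (((f.differentiableAt hX).continuousAt.tendsto.comp htend).congr' hfixed) htend

end NCSelfMap

/-- for an nc self-map fixing the origin, every matrix point whose
coordinates satisfy all homogeneous linear relations of the level-1 fixed point set is
fixed. -/
theorem stmt_5 {d : ℕ} (f : NCSelfMap d) (hf0 : f.app 1 0 = 0) :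
    ∀ n : ℕ, 1 ≤ n → ∀ X ∈ freeBall d n,
      (∀ α : Fin d → ℂ, (∀ v ∈ freeBall d 1, f.app 1 v = v → ∑ j, α j • v j = 0) →
        ∑ j, α j • X j = 0) →
      f.app n X = X := by
  intro n _ X hX hrel
  exact NCSelfMap.SatisfiesFixedRelations.app_eq hf0 hrel hX
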